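/- arXiv:1710.03353 — 3 statements merged into one kernel-verified Lean document; each statement's English description precedes it below -/
import Mathlib

section
/- Let E ⊆ F be fields of characteristic p > 0, and suppose F/E is algebraic with a uniform finite bound on the degrees [E(a):E] for a ∈ F. Then F^(p^∞) is a finite separable extension of E^(p^∞), and moreover [F^(p^∞) : E^(p^∞)] = [E·F^(p^∞) : E]. -/
open Polynomial IntermediateField in
theorem aux_primitive (K L : Type*) [Field K] [Field L] [Algebra K L] [Algebra.IsSeparable K L]
    (N : ℕ) (h : ∀ a : L, (minpoly K a).natDegree ≤ N) : ∃ a : L, K⟮a⟯ = ⊤ := by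
  obtain ⟨a, ha⟩ : ∃ a : L, ∀ b : L, (minpoly K b).natDegree ≤ (minpoly K a).natDegree := by
    have hfin : (Set.range fun a : L => (minpoly K a).natDegree).Finite :=
      (Set.finite_Iic N).subset (by rintro _ ⟨a, rfl⟩; exact h a)
    obtain ⟨_, ⟨a, rfl⟩, hm⟩ := Set.exists_max_image _ id hfin ⟨_, ⟨0, rfl⟩⟩
    exact ⟨a, fun b => hm _ ⟨b, rfl⟩⟩
  refine ⟨a, ?_⟩
  rw [eq_top_iff]
  intro x _
  have hint : ∀ y : L, IsIntegral K y := fun y => Algebra.IsIntegral.isIntegral y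
  have : FiniteDimensional K K⟮a, x⟯ :=
    IntermediateField.finiteDimensional_adjoin (fun y _ => hint y)
  obtain ⟨b, hb⟩ := Field.exists_primitive_element K K⟮a, x⟯
  have hbdeg : Module.finrank K K⟮a, x⟯ = (minpoly K (b : L)).natDegree := by
    rw [(Field.primitive_element_iff_minpoly_natDegree_eq K b).1 hb |>.symm]
    congr 1
    exact (minpoly.algebraMap_eq (B := K⟮a, x⟯) (B' := L) (algebraMap K⟮a, x⟯ L).injective b).symm
  have hle : K⟮a⟯ ≤ K⟮a, x⟯ := by
    apply IntermediateField.adjoin.mono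
    simp
  have heq := IntermediateField.eq_of_le_of_finrank_le hle (by
    rw [hbdeg, IntermediateField.adjoin.finrank (hint a)]; exact ha b)
  rw [heq]
  exact IntermediateField.subset_adjoin K _ (by simp)

theorem aux_root {F : Type*} [Field F] (p : ℕ) [ExpChar F p] (E : Subfield F) {b : F}
    (hb : b ∈ ⨅ n : ℕ, Subfield.map (iterateFrobenius F p n) E) (m : ℕ) :
    ∃ c ∈ ⨅ n : ℕ, Subfield.map (iterateFrobenius F p n) E, c ^ p ^ m = b := by
  simp only [Subfield.mem_iInf, Subfield.mem_map, iterateFrobenius_def] at hb ⊢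
  obtain ⟨c, hc, hcb⟩ := hb m
  refine ⟨c, fun n => ?_, hcb⟩
  obtain ⟨z, hz, hzb⟩ := hb (n + m)
  refine ⟨z, hz, ?_⟩
  apply iterateFrobenius_inj F p m
  simp only [iterateFrobenius_def]
  rw [hcb, ← hzb, pow_add, pow_mul]

open Polynomial in
theorem aux_coeff {F : Type*} [Field F] (p : ℕ) [ExpChar F p]
    (E : Subfield F) (N : ℕ)
    (halg : ∀ a : F, IsIntegral E a)
    (hdeg : ∀ a : F, (minpoly E a).natDegree ≤ N)
    {a : F} (ha : a ∈ ⨅ n : ℕ, Subfield.map (iterateFrobenius F p n) (⊤ : Subfield F)) :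
    ∃ b ∈ ⨅ n : ℕ, Subfield.map (iterateFrobenius F p n) (⊤ : Subfield F),
      (∃ n, b ^ p ^ n = a) ∧
      ∀ i, ((minpoly E b).coeff i : F) ∈ ⨅ n : ℕ, Subfield.map (iterateFrobenius F p n) E := by
  have : ExpChar E p := (algebraMap E F).expChar (algebraMap E F).injective p
  let L : Subfield F := ⨅ n : ℕ, Subfield.map (iterateFrobenius F p n) (⊤ : Subfield F)
  let S : Set F := {b | b ∈ L ∧ ∃ n, b ^ p ^ n = a}
  obtain ⟨b, ⟨hbL, n, hn⟩, hmax⟩ : ∃ b ∈ S, ∀ c ∈ S,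
      (minpoly E c).natDegree ≤ (minpoly E b).natDegree := by
    have hfin : (Set.image (fun a : F => (minpoly E a).natDegree) S).Finite :=
      (Set.finite_Iic N).subset (by rintro _ ⟨a, _, rfl⟩; exact hdeg a)
    obtain ⟨_, ⟨a, haS, rfl⟩, hm⟩ := Set.exists_max_image _ id hfin
      ⟨_, ⟨a, ⟨ha, 0, by simp⟩, rfl⟩⟩
    exact ⟨a, haS, fun b hb => hm _ ⟨b, hb, rfl⟩⟩
  refine ⟨b, hbL, ⟨n, hn⟩, fun i => ?_⟩
  rw [Subfield.mem_iInf]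
  intro m
  obtain ⟨c, hcL, hc⟩ := aux_root p ⊤ hbL m
  have hcS : c ∈ S := ⟨hcL, m + n, by rw [pow_add, pow_mul, hc, hn]⟩
  have hg : (minpoly E c).map (iterateFrobenius E p m) = minpoly E b := by
    apply minpoly.unique_of_degree_le_degree_minpoly
    · exact (minpoly.monic (halg c)).map _
    · have h0 : aeval c (minpoly E c) = 0 := minpoly.aeval E c
      have := congrArg (iterateFrobenius F p m) h0
      rw [aeval_def, hom_eval₂, map_zero, iterateFrobenius_def, hc] at this
      rw [aeval_def, eval₂_map, ← this]
      congr 1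
    · rw [Polynomial.degree_map, Polynomial.degree_eq_natDegree (minpoly.ne_zero (halg c)),
        Polynomial.degree_eq_natDegree (minpoly.ne_zero (halg b))]
      exact_mod_cast hmax c hcS
  rw [← hg, coeff_map]
  exact ⟨((minpoly E c).coeff i : F), ((minpoly E c).coeff i).2, by simp [iterateFrobenius_def]⟩

/-- If `E` is a big subfield of `F` (char `p > 0`), then `F^(p^∞)/E^(p^∞)`
is finite separable, of the same degree as `E·F^(p^∞)/E`. -/
theorem perfect_subfield_finite_separable_degree_eq
    (p : ℕ) (hp : p.Prime) (F : Type*) [Field F] [ExpChar F p]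
    (E : Subfield F) (N : ℕ)
    (halg : ∀ a : F, IsIntegral E a)
    (hdeg : ∀ a : F, (minpoly E a).natDegree ≤ N)
    (Fpinf Epinf M : Subfield F)
    (hFp : Fpinf = ⨅ n : ℕ, (iterateFrobenius F p n).fieldRange)
    (hEp : Epinf = ⨅ n : ℕ, Subfield.map (iterateFrobenius F p n) E)
    (hM : M = E ⊔ Fpinf)
    (h1 : Epinf ≤ Fpinf) (h2 : E ≤ M) :
    letI : Algebra Epinf Fpinf := (Subfield.inclusion h1).toAlgebra
    letI : Algebra E M := (Subfield.inclusion h2).toAlgebra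
    FiniteDimensional Epinf Fpinf ∧ Algebra.IsSeparable Epinf Fpinf ∧
      Module.finrank Epinf Fpinf = Module.finrank E M := by
  letI : Algebra Epinf Fpinf := (Subfield.inclusion h1).toAlgebra
  letI : Algebra E M := (Subfield.inclusion h2).toAlgebra
  have hKE : Epinf ≤ E := by
    rw [hEp]
    exact (iInf_le _ 0).trans (by rintro _ ⟨x, hx, rfl⟩; simpa using hx)
  have : IsScalarTower Epinf Fpinf F := IsScalarTower.of_algebraMap_eq (fun _ => rfl)
  have : IsScalarTower E M F := IsScalarTower.of_algebraMap_eq (fun _ => rfl)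
  simp only [RingHom.fieldRange_eq_map] at hFp
  have : ExpChar Epinf p := (algebraMap Epinf F).expChar (algebraMap Epinf F).injective p
  have : PerfectRing Epinf p := by
    refine PerfectRing.ofSurjective _ p fun x => ?_
    have hx := x.2
    simp only [hEp] at hx
    obtain ⟨c, hc, hcx⟩ := aux_root p E hx 1
    rw [← hEp] at hc
    exact ⟨⟨c, hc⟩, Subtype.ext (by simpa [frobenius_def] using hcx)⟩
  have : PerfectField Epinf := PerfectRing.toPerfectField Epinf p
  -- the key fact
  have key : ∀ a : Fpinf, ∃ b : Fpinf, (∃ n, b ^ p ^ n = a) ∧ IsIntegral Epinf b ∧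
      (minpoly Epinf b).natDegree = (minpoly E (b : F)).natDegree := by
    intro a
    have ha := a.2
    simp only [hFp] at ha
    obtain ⟨b, hb, ⟨n, hn⟩, hcoef⟩ := aux_coeff p E N halg hdeg ha
    rw [← hFp] at hb
    rw [← hEp] at hcoef
    have hlift : (minpoly E b) ∈ Polynomial.lifts (Subfield.inclusion hKE) := by
      rw [Polynomial.lifts_iff_coeff_lifts]
      intro i
      exact ⟨⟨_, hcoef i⟩, rfl⟩
    obtain ⟨q, hq, hqd, hqm⟩ := Polynomial.lifts_and_natDegree_eq_and_monic hlift
      (minpoly.monic (halg b))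
    have hroot : Polynomial.aeval b q = 0 := by
      have h0 : Polynomial.aeval b (minpoly E b) = 0 := minpoly.aeval E b
      rw [← hq, Polynomial.aeval_def, Polynomial.eval₂_map] at h0
      exact h0
    have hroot' : Polynomial.aeval (⟨b, hb⟩ : Fpinf) q = 0 := by
      apply (algebraMap Fpinf F).injective
      rw [← Polynomial.aeval_algebraMap_apply, map_zero]
      exact hroot
    have hmin : q = minpoly Epinf (⟨b, hb⟩ : Fpinf) := by
      apply minpoly.eq_of_irreducible_of_monic _ hroot' hqm
      have := minpoly.irreducible (halg b)
      rw [← hq] at this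
      exact Polynomial.Monic.irreducible_of_irreducible_map _ _ hqm this
    exact ⟨⟨b, hb⟩, ⟨n, Subtype.ext (by simpa using hn)⟩, ⟨q, hqm, hroot'⟩, by rw [← hmin, hqd]⟩
  have : Algebra.IsIntegral Epinf Fpinf := ⟨fun a => by
    obtain ⟨b, ⟨n, rfl⟩, hb, -⟩ := key a
    exact hb.pow _⟩
  have hsep : Algebra.IsSeparable Epinf Fpinf := inferInstance
  have hbound : ∀ a : Fpinf, (minpoly Epinf a).natDegree ≤ N := by
    intro a
    obtain ⟨b, ⟨n, rfl⟩, hb, hd⟩ := key a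
    have := IntermediateField.adjoin.finiteDimensional hb
    rw [← IntermediateField.adjoin.finrank (hb.pow _)]
    refine le_trans ?_ (hd.le.trans (hdeg _))
    rw [← IntermediateField.adjoin.finrank hb]
    apply IntermediateField.finrank_le_of_le_right
    rw [IntermediateField.adjoin_simple_le_iff]
    exact pow_mem (IntermediateField.mem_adjoin_simple_self _ _) _
  obtain ⟨a, ha⟩ := aux_primitive Epinf Fpinf N hbound
  obtain ⟨b, ⟨n, rfl⟩, hb, hd⟩ := key a
  have hbt : IntermediateField.adjoin Epinf {b} = ⊤ := by
    rw [eq_top_iff, ← ha, IntermediateField.adjoin_simple_le_iff]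
    exact pow_mem (IntermediateField.mem_adjoin_simple_self _ _) _
  have hfd : FiniteDimensional Epinf Fpinf := by
    have := IntermediateField.adjoin.finiteDimensional hb
    rw [hbt] at this
    exact Module.Finite.equiv (IntermediateField.topEquiv (F := Epinf) (E := Fpinf)).toLinearEquiv
  refine ⟨hfd, hsep, ?_⟩
  have hLM : Fpinf ≤ M := hM ▸ le_sup_right
  let bM : M := ⟨b, hLM b.2⟩
  have hmb : minpoly E bM = minpoly E (b : F) :=
    (minpoly.algebraMap_eq (B := M) (B' := F) (algebraMap M F).injective bM).symm
  have hbMi : IsIntegral E bM :=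
    (isIntegral_algebraMap_iff (B := F) (algebraMap M F).injective).1 (halg b)
  have hbMt : IntermediateField.adjoin E {bM} = ⊤ := by
    have hle : M ≤ (IntermediateField.adjoin E {bM}).toSubfield.map M.subtype := by
      conv_lhs => rw [hM]
      refine sup_le (fun x hx => ?_) (fun x hx => ?_)
      · exact ⟨algebraMap E M ⟨x, hx⟩, IntermediateField.algebraMap_mem _ _, rfl⟩
      · have hx' : (⟨x, hx⟩ : Fpinf) ∈ (IntermediateField.adjoin Epinf {b}).toSubalgebra := by
          rw [hbt]; trivial
        rw [IntermediateField.adjoin_simple_toSubalgebra_of_isAlgebraic hb.isAlgebraic,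
          Algebra.adjoin_singleton_eq_range_aeval] at hx'
        obtain ⟨q, hq⟩ := hx'
        refine ⟨Polynomial.aeval bM (q.map (Subfield.inclusion hKE)), ?_, ?_⟩
        · exact IntermediateField.algebra_adjoin_le_adjoin E _ (Polynomial.aeval_mem_adjoin_singleton E bM)
        · have e1 := congrArg (algebraMap Fpinf F) hq
          change algebraMap M F _ = x
          change algebraMap Fpinf F (Polynomial.aeval b q) = x at e1
          rw [← e1, ← Polynomial.aeval_algebraMap_apply, ← Polynomial.aeval_algebraMap_apply,
            Polynomial.aeval_def, Polynomial.eval₂_map]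
          rfl
    rw [eq_top_iff]
    intro y _
    obtain ⟨z, hz, hzy⟩ := hle y.2
    have : z = y := Subtype.ext hzy
    exact this ▸ hz
  have f1 := IntermediateField.adjoin.finrank hb
  have f2 := IntermediateField.adjoin.finrank hbMi
  rw [hbt, IntermediateField.finrank_top'] at f1
  rw [hbMt, IntermediateField.finrank_top'] at f2
  rw [f1, f2, hd, hmb]
end

section
/- Let F/C be a separable field extension of fields of characteristic p > 0, and let a ∈ F^(p^∞). Then the field extension F / C(a^(p^{-n}) : n < ω) is separable, where C(a^(p^{-n}) : n < ω) is the subfield generated over C by all p-power roots of a inside F. -/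
/-- Mac Lane's criterion: a (not necessarily algebraic) field extension `F/C` is separable
if every finite subset `s` of `F` contains a separating transcendence base `t` of `C(s)/C`,
i.e. `t` is algebraically independent over `C` and `C(s)` is separably algebraic over `C(t)`. -/
def MacLaneSeparable (C F : Type*) [Field C] [Field F] [Algebra C F] : Prop :=
  ∀ s : Finset F, ∃ t : Finset F, (t : Set F) ⊆ (s : Set F) ∧
    AlgebraicIndependent C (fun x : {y : F // y ∈ t} => (x : F)) ∧
    ∀ x ∈ IntermediateField.adjoin C (s : Set F),
      IsSeparable (IntermediateField.adjoin C (t : Set F)) x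

open IntermediateField Polynomial

theorem isSep_mono {C F : Type*} [Field C] [Field F] [Algebra C F] {K L : IntermediateField C F}
    (h : K ≤ L) {x : F} (hx : IsSeparable K x) : IsSeparable L x := by
  let : Algebra K L := (IntermediateField.inclusion h).toAlgebra
  have : IsScalarTower K L F := .of_algebraMap_eq fun ⟨y, _⟩ ↦ show y = y from rfl
  exact hx.tower_top L

theorem isAlg_mono {C F : Type*} [Field C] [Field F] [Algebra C F] {K L : IntermediateField C F}
    (h : K ≤ L) {x : F} (hx : IsAlgebraic K x) : IsAlgebraic L x := by
  let : Algebra K L := (IntermediateField.inclusion h).toAlgebra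
  have : IsScalarTower K L F := .of_algebraMap_eq fun ⟨y, _⟩ ↦ show y = y from rfl
  exact hx.tower_top L

theorem sep_key {C F : Type*} [Field C] [Field F] [Algebra C F] (D : IntermediateField C F)
    (s t u : Set F) (hu : ∀ x ∈ u, x ∈ D ∨ x ∈ t)
    (hs : ∀ x ∈ s, IsSeparable (adjoin C u) x) :
    ∀ x ∈ adjoin D s, IsSeparable (adjoin D t) x := by
  have hle : adjoin C u ≤ (adjoin D t).restrictScalars C := by
    rw [adjoin_le_iff]
    intro x hx
    rcases hu x hx with h | h
    · exact (adjoin D t).algebraMap_mem ⟨x, h⟩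
    · exact subset_adjoin D t h
  have hs' : ∀ x ∈ s, IsSeparable (adjoin D t) x := fun x hx =>
    isSep_mono (L := (adjoin D t).restrictScalars C) hle (hs x hx)
  have : adjoin D s ≤ (separableClosure (adjoin D t) F).restrictScalars D := by
    rw [adjoin_le_iff]
    exact fun x hx => mem_separableClosure_iff.2 (hs' x hx)
  exact fun x hx => mem_separableClosure_iff.1 (this hx)

/-- `x` transcendental is not in `N(x^p)` in characteristic `p`. -/
theorem notMem_adjoin_pow {N F : Type*} [Field N] [Field F] [Algebra N F] (p : ℕ) (hp : p.Prime)
    [CharP N p] (x : F) (hx : Transcendental N x) : x ∉ N⟮x ^ p⟯ := by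
  intro h
  obtain ⟨r, q, h⟩ := (mem_adjoin_simple_iff N x).1 h
  have hx0 : x ≠ 0 := fun h0 => hx (h0 ▸ isAlgebraic_zero)
  have hq : aeval (x ^ p) q ≠ 0 := by
    intro h0; rw [h0, div_zero] at h; exact hx0 h
  rw [eq_div_iff hq] at h
  have h2 : aeval x (X * expand N p q - expand N p r) = 0 := by
    simp [expand_aeval, h]
  have h3 := (transcendental_iff.1 hx) _ h2
  have h4 := congrArg derivative h3
  simp [derivative_expand] at h4
  rw [expand_eq_zero hp.pos] at h4
  simp [h4] at hq

theorem mem_of_sep_of_pow {E F : Type*} [Field E] [Field F] [Algebra E F] (p : ℕ)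
    [ExpChar E p] (x : F) (n : ℕ) (h : IsSeparable E x)
    (h2 : x ^ p ^ n ∈ (algebraMap E F).range) : x ∈ (algebraMap E F).range := by
  have h3 : x ∈ (separableClosure E F ⊓ perfectClosure E F : IntermediateField E F) :=
    ⟨mem_separableClosure_iff.2 h, (mem_perfectClosure_iff_pow_mem p).2 ⟨n, h2⟩⟩
  rw [separableClosure_inf_perfectClosure] at h3
  exact mem_bot.1 h3

theorem no_tower {C F : Type*} [Field C] [Field F] [Algebra C F] (p : ℕ) (hp : p.Prime)
    [CharP F p] (s : Finset F) (x : ℕ → F) (hx : ∀ n, x (n + 1) ^ p = x n)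
    (hx0 : ∀ n, x n ^ p ^ n = x 0)
    (htr : Transcendental C (x 0))
    (hsep : ∀ n, IsSeparable (adjoin C (s : Set F)) (x n)) : False := by
  obtain ⟨u, hu, hau⟩ := (show (AlgebraicIndependent.matroid C F).Indep {x 0} from by
    rw [AlgebraicIndependent.matroid_indep_iff]
    exact (algebraicIndependent_singleton_iff (x := fun i : ({x 0} : Set F) => id i.1)
      ⟨x 0, rfl⟩).2 htr).subset_isBasis_of_subset
      (X := insert (x 0) (s : Set F)) (by simp) (by simp)
  rw [AlgebraicIndependent.matroid_isBasis_iff] at hu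
  obtain ⟨hind, hus, halg⟩ := hu
  have hau : x 0 ∈ u := by simpa using hau
  let N : IntermediateField C F := adjoin C (u \ {x 0})
  have hN0 : Transcendental N (x 0) := by
    rw [IntermediateField.transcendental_adjoin_iff]
    rw [← Set.insert_sdiff_self_of_mem hau, AlgebraicIndepOn.insert_iff (by simp)] at hind
    have h := hind.2
    rw [Set.image_id] at h
    exact h
  have hNn : ∀ n, Transcendental N (x n) := fun n h => hN0 (hx0 n ▸ h.pow _)
  have : CharP N p := inferInstance
  let M : IntermediateField N F := N⟮x 0⟯
  have hMu : adjoin C u ≤ M.restrictScalars C := by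
    rw [adjoin_le_iff]
    intro y hy
    by_cases h : y = x 0
    · subst h; exact mem_adjoin_simple_self N _
    · exact M.algebraMap_mem ⟨y, subset_adjoin C _ ⟨hy, h⟩⟩
  have hMs : ∀ y ∈ s, IsAlgebraic M y := fun y hy =>
    isAlg_mono (L := M.restrictScalars C) hMu
      (IntermediateField.isAlgebraic_adjoin_iff.2 (halg y (by simp [hy])))
  let E : IntermediateField M F := adjoin M (s : Set F)
  have : FiniteDimensional M E := finiteDimensional_adjoin fun y hy => (hMs y hy).isIntegral
  have hCE : adjoin C (s : Set F) ≤ (E.restrictScalars N).restrictScalars C := by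
    rw [adjoin_le_iff]
    exact fun y hy => subset_adjoin M _ hy
  have : ExpChar E p := by
    have : CharP E p := (algebraMap E F).charP (algebraMap E F).injective p
    have := Fact.mk hp
    exact ExpChar.prime hp
  have hxE : ∀ n, x n ∈ E := fun n => by
    obtain ⟨e, he⟩ := mem_of_sep_of_pow (E := E) p (x n) n
      (isSep_mono (L := (E.restrictScalars N).restrictScalars C) hCE (hsep n))
      ⟨⟨x 0, E.algebraMap_mem ⟨x 0, mem_adjoin_simple_self N _⟩⟩, (hx0 n).symm⟩
    exact he ▸ e.2
  let f : ℕ →o Submodule M E :=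
    { toFun := fun n => (Subalgebra.toSubmodule (M⟮x n⟯).toSubalgebra).comap E.val.toLinearMap
      monotone' := monotone_nat_of_le_succ fun n => by
        apply Submodule.comap_mono
        have : M⟮x n⟯ ≤ M⟮x (n + 1)⟯ := by
          rw [adjoin_simple_le_iff, ← hx n]
          exact pow_mem (mem_adjoin_simple_self M _) _
        exact this }
  obtain ⟨n, hn⟩ := monotone_stabilizes_iff_noetherian.2 (inferInstance : IsNoetherian M E) f
  have h1 : (⟨x (n + 1), hxE _⟩ : E) ∈ f (n + 1) := mem_adjoin_simple_self M (x (n + 1))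
  rw [← hn (n + 1) (by omega)] at h1
  have h2 : x (n + 1) ∈ M⟮x n⟯ := h1
  have hMN : M ≤ N⟮x n⟯ := by
    rw [adjoin_simple_le_iff, ← hx0 n]
    exact pow_mem (mem_adjoin_simple_self N _) _
  have h3 : M⟮x n⟯.restrictScalars N ≤ N⟮x n⟯ := by
    rw [restrictScalars_adjoin, adjoin_le_iff]
    rintro y (hy | hy)
    · exact hMN hy
    · rw [Set.mem_singleton_iff.1 hy]; exact mem_adjoin_simple_self N _
  have h4 := h3 h2
  rw [← hx n] at h4
  exact notMem_adjoin_pow p hp _ (hNn (n + 1)) h4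

/-- If `F/C` is separable (char `p > 0`) and `a ∈ F^(p^∞)`, then
`F / C(a^(p^{-n}) : n < ω)` is separable. -/
theorem macLaneSeparable_over_adjoin_p_power_roots
    (p : ℕ) (hp : p.Prime) (C F : Type*) [Field C] [Field F] [CharP F p]
    [Algebra C F] (hsep : MacLaneSeparable C F)
    (a : F) (ha : a ∈ ⋂ n : ℕ, Set.range fun x : F => x ^ p ^ n) :
    MacLaneSeparable (IntermediateField.adjoin C {x : F | ∃ n : ℕ, x ^ p ^ n = a}) F := by
  classical
  have : Fact p.Prime := ⟨hp⟩
  have ha' : ∀ n : ℕ, ∃ x : F, x ^ p ^ n = a := fun n => by simpa using Set.mem_iInter.1 ha n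
  choose x hxa using ha'
  have hx0' : x 0 = a := by simpa using hxa 0
  have hinj : ∀ n : ℕ, Function.Injective fun y : F => y ^ p ^ n := fun n =>
    iterateFrobenius_inj F p n
  have hx : ∀ n, x (n + 1) ^ p = x n := fun n => hinj n (by
    simp only [hxa, ← pow_mul]
    rw [← pow_succ', hxa])
  intro s
  set D : IntermediateField C F := adjoin C {x : F | ∃ n : ℕ, x ^ p ^ n = a} with hD
  have hxD : ∀ n, x n ∈ D := fun n => subset_adjoin C _ ⟨n, hxa n⟩
  choose t hts hti htsep using fun n => hsep (insert (x n) s)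
  by_cases hA : ∃ n, x n ∈ t n
  · obtain ⟨n, hn⟩ := hA
    refine ⟨(t n).erase (x n), ?_, ?_, ?_⟩
    · intro y hy
      have hy : y ≠ x n ∧ y ∈ t n := Finset.mem_erase.1 (Finset.mem_coe.1 hy)
      have := hts n hy.2
      simpa [hy.1] using this
    · have h1 := (hti n).adjoin_of_disjoint (s := {i | i.1 = x n}) (t := {i | i.1 ≠ x n})
        (Set.disjoint_left.2 fun i h h' => h' h)
      have himg : (fun i : {y : F // y ∈ t n} => (i : F)) '' {i | i.1 = x n} = {x n} := by
        ext y; constructor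
        · rintro ⟨i, hi, rfl⟩; exact hi
        · rintro rfl; exact ⟨⟨x n, hn⟩, rfl, rfl⟩
      rw [himg] at h1
      have hle : Algebra.adjoin C {x n} ≤ D.toSubalgebra := by
        rw [Algebra.adjoin_le_iff]
        rintro y rfl
        exact hxD n
      let _ : Algebra (Algebra.adjoin C {x n}) D := (Subalgebra.inclusion hle).toAlgebra
      have : IsScalarTower (Algebra.adjoin C {x n}) D F :=
        .of_algebraMap_eq fun ⟨y, _⟩ ↦ show y = y from rfl
      have : Algebra.IsAlgebraic (Algebra.adjoin C {x n}) D := by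
        have hle2 : D ≤ (algebraicClosure C⟮x n⟯ F).restrictScalars C := by
          rw [hD, adjoin_le_iff]
          rintro y ⟨m, hm⟩
          have : IsAlgebraic C⟮x n⟯ a := by
            have h := mem_adjoin_simple_self C (x n)
            rw [← hxa n]
            exact isAlgebraic_algebraMap (⟨x n ^ p ^ n, pow_mem h _⟩ : C⟮x n⟯)
          rw [← hm] at this
          exact mem_algebraicClosure_iff.2 (this.of_pow (pow_pos hp.pos _))
        refine ⟨fun y => ?_⟩
        have := mem_algebraicClosure_iff.1 (hle2 y.2)
        rw [IntermediateField.isAlgebraic_adjoin_iff] at this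
        exact (isAlgebraic_algHom_iff (IsScalarTower.toAlgHom (Algebra.adjoin C {x n}) D F)
          Subtype.val_injective).1 this
      have h2 := h1.extendScalars D
      let g : {y : F // y ∈ (t n).erase (x n)} → {i : {y : F // y ∈ t n} | i.1 ≠ x n} :=
        fun y => ⟨⟨y.1, Finset.mem_of_mem_erase y.2⟩, Finset.ne_of_mem_erase y.2⟩
      exact h2.comp g fun y z h => Subtype.ext (congrArg (fun i => i.1.1) h)
    · refine sep_key D _ _ (t n) ?_ fun y hy => htsep n y (subset_adjoin C _ (by
        simp [Finset.mem_coe.1 hy]))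
      intro y hy
      by_cases h : y = x n
      · exact .inl (h ▸ hxD n)
      · exact .inr (by simpa [h] using hy)
  push Not at hA
  have hts' : ∀ n, t n ⊆ s := fun n y hy => by
    have := hts n hy
    have hne : y ≠ x n := fun h => hA n (h ▸ hy)
    simpa [hne] using this
  by_cases htr : IsAlgebraic C a
  · refine ⟨t 0, by exact_mod_cast hts' 0, ?_, ?_⟩
    · have : Algebra.IsAlgebraic C D := IntermediateField.isAlgebraic_adjoin fun y ⟨m, hm⟩ =>
        IsAlgebraic.isIntegral ((hm ▸ htr : IsAlgebraic C (y ^ p ^ m)).of_pow (pow_pos hp.pos _))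
      exact (hti 0).extendScalars D
    · exact sep_key D _ _ (t 0) (fun y hy => .inr hy) fun y hy => htsep 0 y (subset_adjoin C _ (by
        simp [Finset.mem_coe.1 hy]))
  · exfalso
    refine no_tower (C := C) p hp s x hx (fun n => by rw [hxa, hx0']) (by rwa [hx0']) fun n => ?_
    exact isSep_mono (adjoin.mono C _ _ (by exact_mod_cast hts' n))
      (htsep n (x n) (subset_adjoin C _ (by simp)))
end

section
/- Let F be a field with minimal subfield intersection property for separability: the set S of subfields E with C ⊆ E ⊆ F and F/E separable has a minimum element under inclusion. If F ⪯ F* is an elementary extension (in the language of rings), then for any subfield E of F, F/E separable implies F*/E separable; consequently the minimal subfield Λ_F(C) of S computed in F equals the one computed in F*. -/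
open FirstOrder Language FirstOrder.Ring

namespace MLSep

/-- A finite family is generated by an independent subfamily. -/
lemma exists_indep_subfamily (k : Type*) {V : Type*} [Field k] [AddCommGroup V] [Module k V]
    {n : ℕ} (y : Fin n → V) :
    ∃ (m : ℕ) (σ : Fin m → Fin n) (d : Fin n → Fin m → k),
      LinearIndependent k (y ∘ σ) ∧ ∀ i, y i = ∑ j, d i j • y (σ j) := by
  classical
  obtain ⟨b, hb, hspan, hli⟩ := exists_linearIndependent k (Set.range y)
  have hfin : b.Finite := (Set.finite_range y).subset hb
  have := hfin.fintype
  let e := Fintype.equivFin b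
  choose τ hτ using fun x : b => hb x.2
  have hy : y ∘ (fun j => τ (e.symm j)) = (Subtype.val : b → V) ∘ e.symm := by
    ext j; simp [hτ]
  have hmem : ∀ i, ∃ d : Fin (Fintype.card b) → k, y i = ∑ j, d j • y (τ (e.symm j)) := by
    intro i
    have : y i ∈ Submodule.span k (Set.range ((Subtype.val : b → V) ∘ e.symm)) := by
      rw [e.symm.surjective.range_comp, Subtype.range_coe, hspan]
      exact Submodule.subset_span ⟨i, rfl⟩
    rw [← hy, Submodule.mem_span_range_iff_exists_fun] at this
    obtain ⟨d, hd⟩ := this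
    exact ⟨d, hd.symm⟩
  choose d hd using hmem
  refine ⟨Fintype.card b, fun j => τ (e.symm j), d, ?_, hd⟩
  rw [hy]
  exact hli.comp _ e.symm.injective

/-- `p`-th power independence of `c` with coefficients in `K`. -/
def PIndep (p : ℕ) (K : Type*) [Field K] {n : ℕ} (c : Fin n → K) : Prop :=
  ∀ y : Fin n → K, ∑ j, c j * y j ^ p = 0 → ∀ j, y j = 0

/-- Families `p`-independent in `E` stay so in `F`. -/
def Q (p : ℕ) (E F : Type*) [Field E] [Field F] [Algebra E F] : Prop :=
  ∀ (n : ℕ) (c : Fin n → E), PIndep p E c → PIndep p F (fun j => algebraMap E F (c j))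

lemma sum_pow_expand {E F : Type*} [Field E] [Field F] [Algebra E F] (p : ℕ) [ExpChar F p]
    {n m : ℕ} (c : Fin n → F) (d : Fin n → Fin m → E) (z : Fin m → F) :
    ∑ j, c j * (∑ k, d j k • z k) ^ p =
      ∑ k, (∑ j, c j * (algebraMap E F (d j k)) ^ p) * z k ^ p := by
  simp_rw [sum_pow_char p, Algebra.smul_def, mul_pow, Finset.mul_sum, Finset.sum_mul]
  rw [Finset.sum_comm]
  simp_rw [mul_assoc]

lemma PIndep.of_separable {p : ℕ} {L F : Type*} [Field L] [Field F] [Algebra L F] [ExpChar L p]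
    {n : ℕ} {c : Fin n → L} (hc : PIndep p L c) (y : Fin n → F)
    (hy : ∀ j, IsSeparable L (y j)) (h : ∑ j, algebraMap L F (c j) * y j ^ p = 0) :
    ∀ j, y j = 0 := by
  have : ExpChar F p := expChar_of_injective_algebraMap (algebraMap L F).injective p
  obtain ⟨m, σ, d, hli, hd⟩ := exists_indep_subfamily L y
  have h2 := hli.map_pow_expChar_pow_of_isSeparable' p 1 (fun i => hy _)
  rw [Fintype.linearIndependent_iff] at h2
  have h3 := sum_pow_expand p (fun j => algebraMap L F (c j)) d (fun k => y (σ k))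
  simp_rw [← hd] at h3
  rw [h] at h3
  have h4 := h2 (fun k => ∑ j, c j * d j k ^ p) (by
    rw [h3]; simp [Algebra.smul_def])
  intro j
  rw [hd j]
  refine Finset.sum_eq_zero fun k _ => ?_
  rw [hc (fun j => d j k) (h4 k) j, zero_smul]

lemma PIndep.mvPolynomial {p : ℕ} {E σ : Type*} [Field E] [ExpChar E p] (hp : p ≠ 0)
    {n : ℕ} {c : Fin n → E} (hc : PIndep p E c) (f : Fin n → MvPolynomial σ E)
    (h : ∑ j, MvPolynomial.C (c j) * f j ^ p = 0) : ∀ j, f j = 0 := by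
  intro j
  ext m
  have key := hc (fun j => (f j).coeff m) (by
    have := congrArg (MvPolynomial.coeff (p • m)) h
    simpa [MvPolynomial.coeff_sum, MvPolynomial.coeff_C_mul, ← MvPolynomial.map_frobenius_expand p,
      MvPolynomial.coeff_map, MvPolynomial.coeff_expand_smul p hp, frobenius_def] using this) j
  simpa using key

open scoped IntermediateField.algebraAdjoinAdjoin in
lemma PIndep.adjoin {p : ℕ} {E F : Type*} [Field E] [Field F] [Algebra E F] [ExpChar E p]
    (hp : p ≠ 0) {n : ℕ} {c : Fin n → E} (hc : PIndep p E c) (t : Finset F)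
    (ht : AlgebraicIndependent E (fun x : {y : F // y ∈ t} => (x : F))) :
    PIndep p (IntermediateField.adjoin E (t : Set F)) (fun j => algebraMap E _ (c j)) := by
  intro y h
  obtain ⟨b, hb⟩ := IsLocalization.exist_integer_multiples_of_finite
    (nonZeroDivisors (Algebra.adjoin E (t : Set F))) y
  choose r hr using hb
  have hr' : ∀ j, (r j : F) = (b : Algebra.adjoin E (t : Set F)) * (y j : F) := fun j =>
    congrArg Subtype.val (hr j)
  have hf : ∀ j, ∃ f : MvPolynomial {y : F // y ∈ t} E, 
      MvPolynomial.aeval (fun x : {y : F // y ∈ t} => (x : F)) f = r j := by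
    intro j
    have hle : Algebra.adjoin E (t : Set F) ≤
        (MvPolynomial.aeval (R := E) (fun x : {y : F // y ∈ t} => (x : F))).range := by
      rw [← Algebra.adjoin_range_eq_range_aeval]
      exact Algebra.adjoin_mono (by simp)
    exact hle (r j).2
  choose f hf using hf
  have h0 := hc.mvPolynomial hp f (by
    apply ht
    have h1 : ∑ j, algebraMap E F (c j) * (y j : F) ^ p = 0 := by
      have := congrArg (Subtype.val) h
      simpa using this
    simp only [map_sum, map_mul, map_pow, hf, hr', MvPolynomial.aeval_C, map_zero]
    simp_rw [mul_pow, mul_left_comm _ (_ ^ p), ← Finset.mul_sum, h1, mul_zero])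
  intro j
  have h1 := hr' j
  rw [← hf, h0 j, map_zero, eq_comm, mul_eq_zero] at h1
  rcases h1 with h1 | h1
  · exact absurd (Subtype.ext h1) (nonZeroDivisors.ne_zero b.2)
  · exact Subtype.ext h1

lemma Q_of_sep {p : ℕ} {E F : Type*} [Field E] [Field F] [Algebra E F] [ExpChar E p]
    (hp : p ≠ 0) (h : MacLaneSeparable E F) : Q p E F := by
  classical
  intro n c hc y hy
  obtain ⟨t, -, hind, hsep⟩ := h (Finset.univ.image y)
  have : ExpChar (IntermediateField.adjoin E (t : Set F)) p :=
    expChar_of_injective_algebraMap (algebraMap E _).injective p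
  exact (hc.adjoin hp t hind).of_separable y
    (fun j => hsep _ (IntermediateField.subset_adjoin _ _ (by simp))) hy

lemma PIndep.exists_basis {p : ℕ} {E : Type*} [Field E] [ExpChar E p] {n : ℕ} (a : Fin n → E) :
    ∃ (m : ℕ) (c : Fin m → E) (b : Fin n → Fin m → E), PIndep p E c ∧
      ∀ i, a i = ∑ j, c j * b i j ^ p := by
  obtain ⟨m, σ, d, hli, hd⟩ := exists_indep_subfamily (frobenius E p).fieldRange a
  choose b hb using fun i j => (d i j).2
  refine ⟨m, a ∘ σ, b, ?_, ?_⟩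
  · intro y hy j
    rw [Fintype.linearIndependent_iff] at hli
    have := hli (fun j => ⟨frobenius E p (y j), ⟨_, rfl⟩⟩) (by
      rw [← hy]
      refine Finset.sum_congr rfl fun j _ => ?_
      rw [Subfield.smul_def]
      simp [frobenius_def, mul_comm]) j
    have := congrArg Subtype.val this
    exact (map_eq_zero (frobenius E p)).1 this
  · intro i
    rw [hd i]
    refine Finset.sum_congr rfl fun j _ => ?_
    rw [Subfield.smul_def, ← hb]
    simp [frobenius_def, mul_comm]

lemma linearIndependent_of_Q {p : ℕ} {E F : Type*} [Field E] [Field F] [Algebra E F] [ExpChar E p]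
    (hp : p ≠ 0) (h : Q p E F) {n : ℕ} (x : Fin n → F) (hx : LinearIndependent E x) :
    LinearIndependent E (fun i => x i ^ p) := by
  have : ExpChar F p := expChar_of_injective_algebraMap (algebraMap E F).injective p
  rw [Fintype.linearIndependent_iff] at hx ⊢
  intro a ha
  obtain ⟨m, c, b, hc, hb⟩ := PIndep.exists_basis (p := p) a
  have h3 := sum_pow_expand p (fun j => algebraMap E F (c j)) (fun j i => b i j) x
  have h4 := h _ c hc (fun j => ∑ i, b i j • x i) (by
    rw [h3, ← ha]
    refine Finset.sum_congr rfl fun i _ => ?_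
    rw [hb i, Algebra.smul_def]
    simp)
  intro i
  rw [hb i]
  refine Finset.sum_eq_zero fun j _ => ?_
  rw [hx (fun i => b i j) (h4 j) i, zero_pow hp, mul_zero]

lemma exists_sub_charZero {k K : Type*} [Field k] [Field K] [Algebra k K] [CharZero k]
    (s : Set K) (hs : IntermediateField.adjoin k s = ⊤) :
    ∃ t ⊆ s, AlgebraicIndependent k ((↑) : t → K) ∧
      Algebra.IsSeparable (IntermediateField.adjoin k t) K := by
  have : Algebra.IsAlgebraic (Algebra.adjoin k s) K := by
    rw [← IntermediateField.isAlgebraic_adjoin_iff_top, hs, Algebra.isAlgebraic_iff_isIntegral]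
    exact Algebra.isIntegral_of_surjective IntermediateField.topEquiv.surjective
  obtain ⟨t, hts, ht⟩ := exists_isTranscendenceBasis_subset (R := k) s
  have : Algebra.IsAlgebraic (IntermediateField.adjoin k t) K := by
    convert! ht.isAlgebraic_field <;> simp
  exact ⟨t, hts, ht.1, inferInstance⟩

open IntermediateField in
lemma exists_sub_charP {k K : Type*} [Field k] [Field K] [Algebra k K] (p : ℕ) (hp : p.Prime)
    [ExpChar k p]
    (H : ∀ s : Finset K,
      LinearIndepOn k _root_.id (s : Set K) → LinearIndepOn k (· ^ p) (s : Set K))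
    (s : Set K) (hfin : s.Finite) (hs : IntermediateField.adjoin k s = ⊤) :
    ∃ t ⊆ s, AlgebraicIndependent k ((↑) : t → K) ∧
      Algebra.IsSeparable (IntermediateField.adjoin k t) K := by
  have : Algebra.IsAlgebraic (Algebra.adjoin k s) K := by
    rw [← IntermediateField.isAlgebraic_adjoin_iff_top, hs, Algebra.isAlgebraic_iff_isIntegral]
    exact Algebra.isIntegral_of_surjective IntermediateField.topEquiv.surjective
  have hne : {t : Set K | t ⊆ s ∧ IsTranscendenceBasis k ((↑) : t → K)}.Nonempty := by
    obtain ⟨t, hts, ht⟩ := exists_isTranscendenceBasis_subset (R := k) s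
    exact ⟨t, hts, ht⟩
  have hf : {t : Set K | t ⊆ s ∧ IsTranscendenceBasis k ((↑) : t → K)}.Finite :=
    hfin.finite_subsets.subset fun t ht => ht.1
  obtain ⟨t, ⟨hts, ht⟩, hmax⟩ := hf.exists_maximalFor
    (fun t ↦ (separableClosure (adjoin k t) K).restrictScalars k) _ hne
  refine ⟨t, hts, ht.1, ?_⟩
  rw [← separableClosure.eq_top_iff, ← (restrictScalars_injective k).eq_iff,
    restrictScalars_top, eq_top_iff, ← hs, adjoin_le_iff]
  intro n hns
  by_contra hn
  have hnt : n ∉ t := fun h ↦ hn (le_restrictScalars_separableClosure _ (subset_adjoin _ _ h))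
  have ⟨i, hi₁, hi₂⟩ := exists_isTranscendenceBasis_and_isSeparable_of_linearIndepOn_pow'
    p hp (a := id) H t n ht hnt
  rw [Set.image_id] at hi₂
  have hsub : insert n t \ {i} ⊆ s := Set.sdiff_subset.trans (Set.insert_subset hns hts)
  refine not_lt_iff_le_imp_ge.mpr (hmax ⟨hsub, hi₁⟩)
    (SetLike.lt_iff_le_and_exists.mpr ⟨?_, n, ?_, hn⟩)
  · rw [separableClosure_le_separableClosure_iff, adjoin_le_iff]
    intro x hx
    obtain rfl | ne := eq_or_ne x i
    exacts [hi₂, le_restrictScalars_separableClosure _ (subset_adjoin _ _ ⟨.inr hx, ne⟩)]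
  · obtain rfl | ne := eq_or_ne n i
    exacts [hi₂, le_restrictScalars_separableClosure _ (subset_adjoin _ _ ⟨.inl rfl, ne⟩)]

lemma isSeparable_transfer {A B K L : Type*} [Field A] [Field B] [Field K] [Field L]
    [Algebra A K] [Algebra B L] (i : A →+* B) (j : K →+* L)
    (hij : (algebraMap B L).comp i = j.comp (algebraMap A K)) {x : K} (hx : IsSeparable A x) :
    IsSeparable B (j x) := by
  have hroot : Polynomial.aeval (j x) ((minpoly A x).map i) = 0 := by
    rw [Polynomial.aeval_def, Polynomial.eval₂_map, hij, ← Polynomial.hom_eval₂,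
      ← Polynomial.aeval_def, minpoly.aeval, map_zero]
  have hs : ((minpoly A x).map i).Separable := Polynomial.Separable.map hx
  exact hs.of_dvd (minpoly.dvd _ _ hroot)

/-- Transfer from a generated subfield to the big field. -/
lemma sep_of_exists_sub {E F : Type*} [Field E] [Field F] [Algebra E F]
    (h : ∀ (K : IntermediateField E F) (s : Set K), s.Finite → IntermediateField.adjoin E s = ⊤ →
      ∃ t ⊆ s, AlgebraicIndependent E ((↑) : t → K) ∧
      Algebra.IsSeparable (IntermediateField.adjoin E t) K) : MacLaneSeparable E F := by
  classical
  intro s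
  obtain ⟨K, hK⟩ : ∃ K, K = IntermediateField.adjoin E (s : Set F) := ⟨_, rfl⟩
  have himg : (Subtype.val : K → F) '' (Subtype.val ⁻¹' (s : Set F)) = s := by
    apply Set.image_preimage_eq_of_subset
    intro x hx
    exact ⟨⟨x, hK ▸ IntermediateField.subset_adjoin E _ hx⟩, rfl⟩
  obtain ⟨t, hts, hind, hsep⟩ := h K (Subtype.val ⁻¹' (s : Set F))
    (s.finite_toSet.preimage Subtype.val_injective.injOn) (by
      apply IntermediateField.map_injective K.val
      rw [IntermediateField.adjoin_map]
      change IntermediateField.adjoin E ((Subtype.val : K → F) '' _) = _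
      rw [himg, ← AlgHom.fieldRange_eq_map, IntermediateField.fieldRange_val, hK])
  have htf : ((Subtype.val : K → F) '' t).Finite :=
    s.finite_toSet.subset (by rw [← himg]; exact Set.image_mono hts)
  refine ⟨htf.toFinset, ?_, ?_, ?_⟩
  · rw [htf.coe_toFinset, ← himg]; exact Set.image_mono hts
  · have h1 : AlgebraicIndependent E (K.val ∘ ((↑) : t → K)) :=
      hind.map' K.val.injective
    have h2 := h1.comp (fun x : {y : F // y ∈ htf.toFinset} =>
      (⟨((htf.mem_toFinset.1 x.2).choose), (htf.mem_toFinset.1 x.2).choose_spec.1⟩ : t)) (by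
        intro x y hxy
        have hx := (htf.mem_toFinset.1 x.2).choose_spec.2
        have hy := (htf.mem_toFinset.1 y.2).choose_spec.2
        apply Subtype.ext
        rw [← hx, ← hy]
        exact congrArg (fun z : t => ((z : K) : F)) hxy)
    convert h2 using 2 with x
    exact ((htf.mem_toFinset.1 x.2).choose_spec.2).symm
  · intro x hx
    rw [← hK] at hx
    have h1 := hsep.isSeparable' ⟨x, hx⟩
    rw [htf.coe_toFinset]
    have hmem : ∀ z : IntermediateField.adjoin E t, ((z : K) : F) ∈
        IntermediateField.adjoin E ((Subtype.val : K → F) '' t) := by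
      intro z
      have h2 : (IntermediateField.adjoin E t).map K.val =
        IntermediateField.adjoin E ((Subtype.val : K → F) '' t) :=
          IntermediateField.adjoin_map E t K.val
      rw [← h2]
      exact ⟨z, z.2, rfl⟩
    let i : IntermediateField.adjoin E t →+*
        IntermediateField.adjoin E ((Subtype.val : K → F) '' t) :=
      ((algebraMap K F).comp (algebraMap (IntermediateField.adjoin E t) K)).codRestrict
        (IntermediateField.adjoin E ((Subtype.val : K → F) '' t)) hmem
    have hij : (algebraMap (IntermediateField.adjoin E ((Subtype.val : K → F) '' t)) F).comp i =
        (algebraMap K F).comp (algebraMap (IntermediateField.adjoin E t) K) :=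
      RingHom.ext fun z => rfl
    have h5 := isSeparable_transfer (x := (⟨x, hx⟩ : K)) i (algebraMap K F) hij h1
    exact h5

lemma sep_of_charZero {E F : Type*} [Field E] [Field F] [Algebra E F] [CharZero E] :
    MacLaneSeparable E F :=
  sep_of_exists_sub fun _ s _ hs => exists_sub_charZero s hs

lemma sep_of_Q {E F : Type*} [Field E] [Field F] [Algebra E F] (p : ℕ) (hp : p.Prime)
    [ExpChar E p] (h : Q p E F) : MacLaneSeparable E F := by
  refine sep_of_exists_sub fun K s hf hs => exists_sub_charP p hp (fun u hu => ?_) s hf hs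
  let e := u.equivFin
  have h1 : LinearIndependent E (fun i => ((e.symm i : K) : F)) := by
    have h2 : LinearIndependent E (fun i => (e.symm i : K)) :=
      LinearIndependent.comp (v := fun x : u => (x : K)) hu e.symm e.symm.injective
    exact h2.map' K.val.toLinearMap (LinearMap.ker_eq_bot_of_injective K.val.injective)
  have h2 := linearIndependent_of_Q hp.ne_zero h _ h1
  have h3 : LinearIndependent E (fun i => (e.symm i : K) ^ p) :=
    LinearIndependent.of_comp K.val.toLinearMap h2
  have h4 := h3.comp e e.injective
  change LinearIndependent E (fun x : u => (x : K) ^ p)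
  simpa [Function.comp_def] using h4

lemma PIndep.elem {F F' : Type*} [Field F] [Field F'] [CompatibleRing F] [CompatibleRing F']
    (g : F →+* F')
    (helem : ∀ (n : ℕ) (φ : Language.ring.Formula (Fin n)) (x : Fin n → F),
      φ.Realize (g ∘ x) ↔ φ.Realize x) (p : ℕ) {n : ℕ} (c : Fin n → F) :
    PIndep p F' (g ∘ c) ↔ PIndep p F c := by
  let P : FreeCommRing (Fin n ⊕ Fin n) :=
    ∑ j, FreeCommRing.of (Sum.inl j) * FreeCommRing.of (Sum.inr j) ^ p
  let φ : Language.ring.Formula (Fin n) := Formula.iAlls (Fin n)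
    (((termOfFreeCommRing P).equal 0).imp
      (Formula.iInf fun j : Fin n => (Term.var (Sum.inr j)).equal 0))
  have h := helem n φ c
  simpa [φ, P, PIndep, Formula.realize_iAlls, Formula.realize_imp, Formula.realize_equal] using h

lemma Q_map {F F' : Type*} [Field F] [Field F'] [CompatibleRing F] [CompatibleRing F']
    (g : F →+* F')
    (helem : ∀ (n : ℕ) (φ : Language.ring.Formula (Fin n)) (x : Fin n → F),
      φ.Realize (g ∘ x) ↔ φ.Realize x) (p : ℕ) (E : Subfield F) :
    Q p (Subfield.map g E) F' ↔ Q p E F := by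
  have key : ∀ {n : ℕ} (c : Fin n → E),
      PIndep p (Subfield.map g E) (fun j => ⟨g (c j), ⟨_, (c j).2, rfl⟩⟩) ↔ PIndep p E c := by
    intro n c
    constructor
    · intro h y hy j
      have := h (fun j => ⟨g (y j), ⟨_, (y j).2, rfl⟩⟩) (by
        apply Subtype.ext
        have := congrArg (fun z : E => g z) hy
        simpa using this) j
      have := congrArg Subtype.val this
      apply Subtype.ext
      exact (map_eq_zero g).1 this
    · intro h y hy j
      choose z hz hzy using fun j => (y j).2
      have h1 := h (fun j => ⟨z j, hz j⟩) (by
        apply Subtype.ext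
        apply g.injective
        have := congrArg Subtype.val hy
        simp only [← hzy, AddSubmonoidClass.coe_finsetSum, MulMemClass.coe_mul,
          SubmonoidClass.coe_pow, ZeroMemClass.coe_zero, ← map_pow, ← map_mul, ← map_sum] at this
        simpa using this) j
      apply Subtype.ext
      rw [← hzy j, show z j = 0 from congrArg Subtype.val h1]
      simp
  constructor
  · intro h n c hc
    exact (PIndep.elem g helem p _).1 (h n _ ((key c).2 hc))
  · intro h n c hc
    choose z hz hzy using fun j => (c j).2
    have hc' : c = fun j => ⟨g ((⟨z j, hz j⟩ : E) : F), ⟨_, hz j, rfl⟩⟩ := by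
      funext j; exact Subtype.ext (hzy j).symm
    rw [hc'] at hc ⊢
    exact (PIndep.elem g helem p _).2 (h n _ ((key _).1 hc))

lemma sep_map_iff {F F' : Type*} [Field F] [Field F'] [CompatibleRing F] [CompatibleRing F']
    (g : F →+* F')
    (helem : ∀ (n : ℕ) (φ : Language.ring.Formula (Fin n)) (x : Fin n → F),
      φ.Realize (g ∘ x) ↔ φ.Realize x) (E : Subfield F) :
    MacLaneSeparable (Subfield.map g E) F' ↔ MacLaneSeparable E F := by
  obtain _ | ⟨p, hp, hpk⟩ := CharP.exists' F
  · have : CharZero F' := charZero_of_injective_ringHom g.injective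
    have : CharZero E := (algebraMap E F).charZero
    have : CharZero (Subfield.map g E) := (algebraMap (Subfield.map g E) F').charZero
    exact ⟨fun _ => sep_of_charZero, fun _ => sep_of_charZero⟩
  · have : ExpChar F p := .prime hp.out
    have : ExpChar F' p := expChar_of_injective_ringHom g.injective p
    have : ExpChar E p := (algebraMap E F).expChar (algebraMap E F).injective p
    have : ExpChar (Subfield.map g E) p := (algebraMap (Subfield.map g E) F').expChar
      (algebraMap (Subfield.map g E) F').injective p
    exact ⟨fun h => sep_of_Q p hp.out ((Q_map g helem p E).1 (Q_of_sep hp.out.ne_zero h)),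
      fun h => sep_of_Q p hp.out ((Q_map g helem p E).2 (Q_of_sep hp.out.ne_zero h))⟩

end MLSep

/-- If `g : F → F*` is an elementary embedding of fields (in the language of
rings), then separability of `F` over a subfield `E` transfers to `F*` over (the image of)
`E`; consequently the minimum subfield `Λ_F(C)` among those over which `F` is separable and
which contain `C` is mapped onto the corresponding minimum `Λ_{F*}(C)` for `F*`. -/
theorem macLaneSeparable_elementary_extension
    (F F' : Type*) [Field F] [Field F'] [CompatibleRing F] [CompatibleRing F']
    (g : F →+* F')
    (helem : ∀ (n : ℕ) (φ : Language.ring.Formula (Fin n)) (x : Fin n → F),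
      φ.Realize (g ∘ x) ↔ φ.Realize x)
    (C D : Subfield F) (D' : Subfield F')
    (hD : IsLeast {E : Subfield F | C ≤ E ∧ MacLaneSeparable E F} D)
    (hD' : IsLeast {E' : Subfield F' | Subfield.map g C ≤ E' ∧ MacLaneSeparable E' F'} D') :
    (∀ E : Subfield F, MacLaneSeparable E F → MacLaneSeparable (Subfield.map g E) F') ∧
      Subfield.map g D = D' := by
  refine ⟨fun E hE => (MLSep.sep_map_iff g helem E).2 hE, ?_⟩
  have hle : D' ≤ Subfield.map g D :=
    hD'.2 ⟨(Subfield.gc_map_comap g).monotone_l hD.1.1, (MLSep.sep_map_iff g helem D).2 hD.1.2⟩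
  have hmap : Subfield.map g (Subfield.comap g D') = D' := by
    apply le_antisymm
    · rintro _ ⟨x, hx, rfl⟩
      exact hx
    · intro x hx
      obtain ⟨y, -, rfl⟩ := hle hx
      exact ⟨y, hx, rfl⟩
  have h2 : D ≤ Subfield.comap g D' := by
    refine hD.2 ⟨fun x hx => hD'.1.1 ⟨x, hx, rfl⟩, ?_⟩
    rw [← MLSep.sep_map_iff g helem, hmap]
    exact hD'.1.2
  refine le_antisymm ?_ hle
  rintro _ ⟨x, hx, rfl⟩
  exact h2 hx
end
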